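/- The cubic fields defined by x³+2x+11, x³−16x+27, x³−x²+9x−8, and x³−x²+3x+10 all have discriminant −3299 (a prime), are pairwise non-isomorphic, and have pairwise equivalent integral trace forms. -/

import Mathlib

open NumberField Module

/-- Two number fields have equivalent integral trace forms if there is a `ℤ`-linear
isomorphism of the rings of integers preserving the trace pairing `(x, y) ↦ tr(x * y)`. -/
def IntTraceEquiv (F L : Type*) [Field F] [NumberField F] [Field L] [NumberField L] : Prop :=
  ∃ e : 𝓞 F ≃ₗ[ℤ] 𝓞 L, ∀ x y : 𝓞 F,
    Algebra.traceForm ℤ (𝓞 L) (e x) (e y) = Algebra.traceForm ℤ (𝓞 F) x y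

section helpers
open Polynomial

/-- The monic cubic with integer coefficients `1, a, b, c`. -/
noncomputable def cubicP (a b c : ℤ) : ℤ[X] := X ^ 3 + C a * X ^ 2 + C b * X + C c

lemma cubicP_natDegree (a b c : ℤ) : (cubicP a b c).natDegree = 3 := by
  unfold cubicP; compute_degree!

lemma cubicP_monic (a b c : ℤ) : (cubicP a b c).Monic := by
  unfold cubicP; monicity!

lemma cubicP_irreducible (a b c : ℤ) (p : ℕ) [Fact p.Prime]
    (hp : ∀ t : ZMod p, t ^ 3 + a * t ^ 2 + b * t + c ≠ 0) : Irreducible (cubicP a b c) := by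
  have hm := cubicP_monic a b c
  refine hm.irreducible_of_irreducible_map (Int.castRingHom (ZMod p)) _ ?_
  have hd : ((cubicP a b c).map (Int.castRingHom (ZMod p))).natDegree = 3 := by
    rw [hm.natDegree_map, cubicP_natDegree]
  rw [irreducible_iff_roots_eq_zero_of_degree_le_three (by omega) (by omega)]
  rw [Multiset.eq_zero_iff_forall_notMem]
  intro t ht
  rw [mem_roots (hm.map _).ne_zero, IsRoot] at ht
  apply hp t
  simpa [cubicP] using ht

/-- The facts about a generator of a cubic field that we use. -/
structure CubicGen (K : Type*) [Field K] [NumberField K] (θ : 𝓞 K) (a b c : ℤ) : Prop where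
  eq : θ ^ 3 + a * θ ^ 2 + b * θ + c = 0
  rank : finrank ℚ K = 3
  tr0 : Algebra.trace ℤ (𝓞 K) 1 = 3
  tr1 : Algebra.trace ℤ (𝓞 K) θ = -a
  tr2 : Algebra.trace ℤ (𝓞 K) (θ ^ 2) = a ^ 2 - 2 * b
  dvd : ∀ q : ℤ[X], aeval θ q = 0 → cubicP a b c ∣ q

lemma exists_cubicGen {K : Type*} [Field K] [NumberField K] (x : K) (a b c : ℤ)
    (h : x ^ 3 + a * x ^ 2 + b * x + c = 0) (hg : Algebra.adjoin ℚ {x} = ⊤)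
    (p : ℕ) [Fact p.Prime] (hp : ∀ t : ZMod p, t ^ 3 + a * t ^ 2 + b * t + c ≠ 0) :
    ∃ θ : 𝓞 K, (θ : K) = x ∧ CubicGen K θ a b c := by
  have hirr := cubicP_irreducible a b c p hp
  have hm := cubicP_monic a b c
  have hx0 : aeval x (cubicP a b c) = 0 := by simpa [cubicP] using h
  have hint : IsIntegral ℤ x := ⟨cubicP a b c, hm, by simpa [aeval_def] using hx0⟩
  have hirrQ : Irreducible ((cubicP a b c).map (Int.castRingHom ℚ)) :=
    (IsPrimitive.Int.irreducible_iff_irreducible_map_cast hm.isPrimitive).1 hirr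
  have hminQ : minpoly ℚ x = (cubicP a b c).map (Int.castRingHom ℚ) := by
    symm
    apply minpoly.eq_of_irreducible_of_monic hirrQ
    · have : (Int.castRingHom ℚ) = algebraMap ℤ ℚ := rfl
      rw [this, aeval_map_algebraMap, hx0]
    · exact hm.map _
  have hintQ : IsIntegral ℚ x := hint.tower_top
  let pb := PowerBasis.ofAdjoinEqTop hintQ hg
  have hgen : pb.gen = x := rfl
  have hdim : pb.dim = 3 := by
    have : pb.dim = (minpoly ℚ x).natDegree := rfl
    rw [this, hminQ, hm.natDegree_map, cubicP_natDegree]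
  let B : Basis (Fin 3) ℚ K := pb.basis.reindex (finCongr hdim)
  have hB : ∀ i, B i = x ^ (i : ℕ) := by
    intro i
    simp [B, hgen]
  have hB0 : B 0 = 1 := by simp [hB]
  have hB1 : B 1 = x := by simp [hB]
  have hB2 : B 2 = x ^ 2 := by simp [hB]
  have hrank : finrank ℚ K = 3 := by
    rw [finrank_eq_card_basis B]; simp
  have e3 : x * B 2 = (-c : ℚ) • B 0 + (-b : ℚ) • B 1 + (-a : ℚ) • B 2 := by
    rw [hB0, hB1, hB2]; simp only [Algebra.smul_def, map_neg, map_intCast]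
    linear_combination h
  have e4 : x ^ 2 * B 2 = (a * c : ℚ) • B 0 + (a * b - c : ℚ) • B 1 + (a ^ 2 - b : ℚ) • B 2 := by
    rw [hB0, hB1, hB2]
    simp only [Algebra.smul_def, map_sub, map_mul, map_pow, map_intCast]
    linear_combination (x - a) * h
  have f1 : x * B 0 = B 1 := by rw [hB0, hB1, mul_one]
  have f2 : x * B 1 = B 2 := by rw [hB1, hB2]; ring
  have f3 : x ^ 2 * B 0 = B 2 := by rw [hB0, hB2]; ring
  have f4 : x ^ 2 * B 1 = x * B 2 := by rw [hB1, hB2]; ring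
  have t1 : Algebra.trace ℚ K x = -a := by
    rw [Algebra.trace_eq_matrix_trace B, Matrix.trace, Fin.sum_univ_three]
    simp only [Matrix.diag, Algebra.leftMulMatrix_eq_repr_mul, f1, f2, e3]
    simp
  have t2 : Algebra.trace ℚ K (x ^ 2) = a ^ 2 - 2 * b := by
    rw [Algebra.trace_eq_matrix_trace B, Matrix.trace, Fin.sum_univ_three]
    simp only [Matrix.diag, Algebra.leftMulMatrix_eq_repr_mul, f3, f4, e3, e4]
    simp
    ring
  have t0 : Algebra.trace ℚ K 1 = 3 := by
    have := Algebra.trace_algebraMap (S := K) (1 : ℚ)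
    rw [map_one, hrank] at this
    simpa using this
  obtain ⟨θ, hθ⟩ : ∃ θ : 𝓞 K, (θ : K) = x := ⟨⟨x, hint⟩, rfl⟩
  subst hθ
  refine ⟨θ, rfl, ?_, hrank, ?_, ?_, ?_, ?_⟩
  · apply RingOfIntegers.ext
    simp only [map_add, map_mul, map_pow, map_intCast, map_zero]
    exact h
  · have := Algebra.coe_trace_int (K := K) (1 : 𝓞 K)
    rw [show ((1 : 𝓞 K) : K) = 1 from rfl, t0] at this
    exact_mod_cast this
  · have := Algebra.coe_trace_int (K := K) θ
    rw [t1] at this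
    exact_mod_cast this
  · have := Algebra.coe_trace_int (K := K) (θ ^ 2)
    rw [show ((θ ^ 2 : 𝓞 K) : K) = (θ : K) ^ 2 from rfl, t2] at this
    exact_mod_cast this
  · intro q hq
    have hqL : aeval (θ : K) q = 0 := by
      have := aeval_algebraMap_apply K θ q
      rw [hq, map_zero] at this
      exact this
    have hmin : minpoly ℤ (θ : K) = cubicP a b c := by
      apply map_injective (Int.castRingHom ℚ) Int.cast_injective
      rw [← hminQ]
      exact (minpoly.isIntegrallyClosed_eq_field_fractions' ℚ hint).symm
    rw [← hmin]
    exact minpoly.isIntegrallyClosed_dvd hint hqL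

lemma basis_of_discr {K : Type*} [Field K] [NumberField K] (hr : finrank ℚ K = 3)
    (v : Fin 3 → 𝓞 K) (hv : Algebra.discr ℤ v = -3299) :
    ∃ B : Basis (Fin 3) ℤ (𝓞 K), ⇑B = v := by
  have hc : Fintype.card (Free.ChooseBasisIndex ℤ (𝓞 K)) = 3 := by
    rw [← finrank_eq_card_chooseBasisIndex, RingOfIntegers.rank, hr]
  let B₀ : Basis (Fin 3) ℤ (𝓞 K) := (RingOfIntegers.basis K).reindex (Fintype.equivFinOfCardEq hc)
  have key : Algebra.discr ℤ v = (B₀.toMatrix v).det ^ 2 * Algebra.discr ℤ B₀ := by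
    rw [← Algebra.discr_of_matrix_vecMul]
    congr 1
    ext1 i
    conv_lhs => rw [← B₀.sum_repr (v i)]
    simp [Matrix.vecMul, dotProduct, Basis.toMatrix_apply, mul_comm]
  have hu : IsUnit (B₀.det v) := by
    rw [Basis.det_apply]
    have hd : (B₀.toMatrix v).det * (B₀.toMatrix v).det ∣ (3299 : ℤ) :=
      ⟨-Algebra.discr ℤ B₀, by linear_combination hv.symm.trans key * (-1)⟩
    have hpr : Prime (3299 : ℤ) := by
      have : Nat.Prime 3299 := by norm_num
      exact_mod_cast Nat.prime_iff_prime_int.1 this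
    exact hpr.squarefree _ hd
  obtain ⟨h1, h2⟩ := (B₀.is_basis_iff_det).2 hu
  exact ⟨Basis.mk h1 h2.ge, Basis.coe_mk _ _⟩

/-- The element with coordinates `u` in terms of `1, θ, θ²`. -/
noncomputable def elt {R : Type*} [CommRing R] (θ : R) (u : Fin 3 → ℤ) : R :=
  (u 0 : R) + u 1 * θ + u 2 * θ ^ 2

lemma trace_intCast_mul {K : Type*} [Field K] [NumberField K] (n : ℤ) (y : 𝓞 K) :
    Algebra.trace ℤ (𝓞 K) ((n : 𝓞 K) * y) = n * Algebra.trace ℤ (𝓞 K) y := by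
  rw [← zsmul_eq_mul, map_zsmul, smul_eq_mul]

lemma trace_elt_mul {K : Type*} [Field K] [NumberField K] {θ : 𝓞 K} {a b c : ℤ}
    (H : CubicGen K θ a b c) (u w : Fin 3 → ℤ) :
    Algebra.trace ℤ (𝓞 K) (elt θ u * elt θ w) =
      u 0 * w 0 * 3 + (u 0 * w 1 + u 1 * w 0) * (-a)
      + (u 0 * w 2 + u 1 * w 1 + u 2 * w 0) * (a ^ 2 - 2 * b)
      + (u 1 * w 2 + u 2 * w 1) * (-a * (a ^ 2 - 2 * b) - b * (-a) - c * 3)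
      + u 2 * w 2 * (-a * (-a * (a ^ 2 - 2 * b) - b * (-a) - c * 3) - b * (a ^ 2 - 2 * b)
        - c * (-a)) := by
  have e : elt θ u * elt θ w =
      ((u 0 * w 0 - c * (u 1 * w 2 + u 2 * w 1) + a * c * (u 2 * w 2) : ℤ) : 𝓞 K) * 1
      + ((u 0 * w 1 + u 1 * w 0 - b * (u 1 * w 2 + u 2 * w 1)
          + (a * b - c) * (u 2 * w 2) : ℤ) : 𝓞 K) * θ
      + ((u 0 * w 2 + u 1 * w 1 + u 2 * w 0 - a * (u 1 * w 2 + u 2 * w 1)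
          + (a ^ 2 - b) * (u 2 * w 2) : ℤ) : 𝓞 K) * θ ^ 2 := by
    unfold elt
    push_cast
    linear_combination ((u 1 * w 2 + u 2 * w 1 : 𝓞 K) + u 2 * w 2 * (θ - a)) * H.eq
  rw [e, map_add, map_add, trace_intCast_mul, trace_intCast_mul, trace_intCast_mul,
    H.tr0, H.tr1, H.tr2]
  ring

lemma power_basis {K : Type*} [Field K] [NumberField K] {θ : 𝓞 K} {a b c : ℤ}
    (H : CubicGen K θ a b c)
    (hd : a ^ 2 * b ^ 2 - 4 * b ^ 3 - 4 * a ^ 3 * c - 27 * c ^ 2 + 18 * a * b * c = -3299) :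
    ∃ B : Basis (Fin 3) ℤ (𝓞 K), ∀ i, B i = elt θ (Pi.single i 1) := by
  obtain ⟨B, hB⟩ := basis_of_discr H.rank (fun i => elt θ (Pi.single i 1)) (by
    rw [Algebra.discr_def, Matrix.det_fin_three]
    simp only [Algebra.traceMatrix_apply, Algebra.traceForm_apply, trace_elt_mul H]
    simp
    rw [← hd]; ring)
  exact ⟨B, fun i => by rw [hB]⟩

lemma discr_of_cubicGen {K : Type*} [Field K] [NumberField K] {θ : 𝓞 K} {a b c : ℤ}
    (H : CubicGen K θ a b c)
    (hd : a ^ 2 * b ^ 2 - 4 * b ^ 3 - 4 * a ^ 3 * c - 27 * c ^ 2 + 18 * a * b * c = -3299) :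
    NumberField.discr K = -3299 := by
  obtain ⟨B, hB⟩ := power_basis H hd
  rw [← NumberField.discr_eq_discr K B, Algebra.discr_def, Matrix.det_fin_three]
  simp only [Algebra.traceMatrix_apply, Algebra.traceForm_apply, hB, trace_elt_mul H]
  simp
  rw [← hd]; ring

/-- A root of one cubic in the field of another one gives roots modulo primes. -/
lemma not_algEquiv {K L : Type*} [Field K] [NumberField K] [Field L] [NumberField L]
    {θ : 𝓞 K} {a b c : ℤ} (H : CubicGen K θ a b c)
    (hd : a ^ 2 * b ^ 2 - 4 * b ^ 3 - 4 * a ^ 3 * c - 27 * c ^ 2 + 18 * a * b * c = -3299)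
    {η : 𝓞 L} {aL bL cL : ℤ} (HL : CubicGen L η aL bL cL)
    (p : ℕ) (r : ZMod p) (hr : r ^ 3 + a * r ^ 2 + b * r + c = 0)
    (hp : ∀ t : ZMod p, t ^ 3 + aL * t ^ 2 + bL * t + cL ≠ 0)
    (e : L ≃ₐ[ℚ] K) : False := by
  obtain ⟨B, hB⟩ := power_basis H hd
  let z : 𝓞 K := RingOfIntegers.mapRingEquiv e.toRingEquiv η
  have hz : z ^ 3 + aL * z ^ 2 + bL * z + cL = 0 := by
    have := congrArg (RingOfIntegers.mapRingEquiv e.toRingEquiv) HL.eq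
    simpa using this
  let q : ℤ[X] := C (B.repr z 0) + C (B.repr z 1) * X + C (B.repr z 2) * X ^ 2
  have hq : aeval θ q = z := by
    conv_rhs => rw [← B.sum_repr z]
    simp [q, Fin.sum_univ_three, hB, elt, Pi.single_apply]
  have h0 : aeval θ ((cubicP aL bL cL).comp q) = 0 := by
    rw [aeval_comp, hq]
    simpa [cubicP] using hz
  obtain ⟨s, hs⟩ := H.dvd _ h0
  have := congrArg (eval₂ (Int.castRingHom (ZMod p)) r) hs
  rw [eval₂_mul, eval₂_comp] at this
  apply hp (eval₂ (Int.castRingHom (ZMod p)) r q)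
  have h1 : eval₂ (Int.castRingHom (ZMod p)) r (cubicP a b c) = 0 := by
    simpa [cubicP, -eq_intCast, -map_intCast, eval₂_C] using hr
  rw [h1, zero_mul] at this
  simpa [cubicP, -eq_intCast, -map_intCast, eval₂_C] using this

/-- The common Gram matrix of the four trace forms. -/
def gramM : Matrix (Fin 3) (Fin 3) ℤ := !![-6, -12, -5; -12, 11, 14; -5, 14, 28]

/-- `K` has an integral basis whose trace form has the common Gram matrix. -/
def HasGram (K : Type*) [Field K] [NumberField K] : Prop :=
  ∃ B : Basis (Fin 3) ℤ (𝓞 K), ∀ i j, Algebra.traceForm ℤ (𝓞 K) (B i) (B j) = gramM i j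

lemma hasGram_of {K : Type*} [Field K] [NumberField K] {θ : 𝓞 K} {a b c : ℤ}
    (H : CubicGen K θ a b c) (u : Fin 3 → Fin 3 → ℤ)
    (hu : ∀ i j, u i 0 * u j 0 * 3 + (u i 0 * u j 1 + u i 1 * u j 0) * (-a)
      + (u i 0 * u j 2 + u i 1 * u j 1 + u i 2 * u j 0) * (a ^ 2 - 2 * b)
      + (u i 1 * u j 2 + u i 2 * u j 1) * (-a * (a ^ 2 - 2 * b) - b * (-a) - c * 3)
      + u i 2 * u j 2 * (-a * (-a * (a ^ 2 - 2 * b) - b * (-a) - c * 3) - b * (a ^ 2 - 2 * b)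
        - c * (-a)) = gramM i j) : HasGram K := by
  have hg : ∀ i j, Algebra.traceForm ℤ (𝓞 K) (elt θ (u i)) (elt θ (u j)) = gramM i j := by
    intro i j
    rw [Algebra.traceForm_apply, trace_elt_mul H, hu]
  obtain ⟨B, hB⟩ := basis_of_discr H.rank (fun i => elt θ (u i)) (by
    rw [Algebra.discr_def]
    have : Algebra.traceMatrix ℤ (fun i => elt θ (u i)) = gramM := by
      ext i j
      rw [Algebra.traceMatrix_apply, hg]
    rw [this]
    decide)
  exact ⟨B, fun i j => by rw [hB]; exact hg i j⟩

lemma intTraceEquiv_of {K L : Type*} [Field K] [NumberField K] [Field L] [NumberField L]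
    (hK : HasGram K) (hL : HasGram L) : IntTraceEquiv K L := by
  obtain ⟨B, hB⟩ := hK
  obtain ⟨BL, hBL⟩ := hL
  refine ⟨B.equiv BL (Equiv.refl _), fun x y => ?_⟩
  have : (Algebra.traceForm ℤ (𝓞 L)).compl₁₂ (B.equiv BL (Equiv.refl _)).toLinearMap
      (B.equiv BL (Equiv.refl _)).toLinearMap = Algebra.traceForm ℤ (𝓞 K) := by
    apply LinearMap.BilinForm.ext_basis B
    intro i j
    simp [LinearMap.compl₁₂_apply, hB, hBL, -Algebra.traceForm_apply]
  exact LinearMap.congr_fun₂ this x y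

instance fact_prime_five : Fact (Nat.Prime 5) := ⟨by norm_num⟩

end helpers

/-- The cubic fields defined by `x³+2x+11`, `x³-16x+27`, `x³-x²+9x-8` and
`x³-x²+3x+10` all have discriminant `-3299` (a prime), are pairwise non-isomorphic, and have
pairwise equivalent integral trace forms. -/
theorem statement_11
    (K₁ K₂ K₃ K₄ : Type*)
    [Field K₁] [NumberField K₁] [Field K₂] [NumberField K₂]
    [Field K₃] [NumberField K₃] [Field K₄] [NumberField K₄]
    (x₁ : K₁) (h₁ : x₁ ^ 3 + 2 * x₁ + 11 = 0) (hg₁ : Algebra.adjoin ℚ {x₁} = ⊤)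
    (x₂ : K₂) (h₂ : x₂ ^ 3 - 16 * x₂ + 27 = 0) (hg₂ : Algebra.adjoin ℚ {x₂} = ⊤)
    (x₃ : K₃) (h₃ : x₃ ^ 3 - x₃ ^ 2 + 9 * x₃ - 8 = 0) (hg₃ : Algebra.adjoin ℚ {x₃} = ⊤)
    (x₄ : K₄) (h₄ : x₄ ^ 3 - x₄ ^ 2 + 3 * x₄ + 10 = 0) (hg₄ : Algebra.adjoin ℚ {x₄} = ⊤) :
    Nat.Prime 3299 ∧
    (NumberField.discr K₁ = -3299 ∧ NumberField.discr K₂ = -3299 ∧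
      NumberField.discr K₃ = -3299 ∧ NumberField.discr K₄ = -3299) ∧
    (¬ Nonempty (K₁ ≃ₐ[ℚ] K₂) ∧ ¬ Nonempty (K₁ ≃ₐ[ℚ] K₃) ∧ ¬ Nonempty (K₁ ≃ₐ[ℚ] K₄) ∧
      ¬ Nonempty (K₂ ≃ₐ[ℚ] K₃) ∧ ¬ Nonempty (K₂ ≃ₐ[ℚ] K₄) ∧ ¬ Nonempty (K₃ ≃ₐ[ℚ] K₄)) ∧
    (IntTraceEquiv K₁ K₂ ∧ IntTraceEquiv K₁ K₃ ∧ IntTraceEquiv K₁ K₄ ∧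
      IntTraceEquiv K₂ K₃ ∧ IntTraceEquiv K₂ K₄ ∧ IntTraceEquiv K₃ K₄) := by
  obtain ⟨θ₁, -, H₁⟩ := exists_cubicGen x₁ 0 2 11 (by push_cast; linear_combination h₁) hg₁ 5
    (by decide)
  obtain ⟨θ₂, -, H₂⟩ := exists_cubicGen x₂ 0 (-16) 27 (by push_cast; linear_combination h₂) hg₂ 5
    (by decide)
  obtain ⟨θ₃, -, H₃⟩ := exists_cubicGen x₃ (-1) 9 (-8) (by push_cast; linear_combination h₃) hg₃ 5
    (by decide)
  obtain ⟨θ₄, -, H₄⟩ := exists_cubicGen x₄ (-1) 3 10 (by push_cast; linear_combination h₄) hg₄ 3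
    (by decide)
  have G₁ : HasGram K₁ := hasGram_of H₁ ![![-114236, 32773, 36377], ![-475307, 136360, 151356],
    ![-181866, 52175, 57914]] (by
      intro i j; fin_cases i <;> fin_cases j <;> simp [gramM])
  have G₂ : HasGram K₂ := hasGram_of H₂ ![![4562050, -1522131, -625203],
    ![267811, -89356, -36702], ![2120562, -707528, -290611]] (by
      intro i j; fin_cases i <;> fin_cases j <;> simp [gramM])
  have G₃ : HasGram K₃ := hasGram_of H₃ ![![-1012228, 693635, -324981],
    ![-1915773, 1312798, -615070], ![867271, -594300, 278441]] (by
      intro i j; fin_cases i <;> fin_cases j <;> simp [gramM])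
  have G₄ : HasGram K₄ := hasGram_of H₄ ![![-421794, -497257, 1266239],
    ![-24761, -29194, 74340], ![-196061, -231143, 588592]] (by
      intro i j; fin_cases i <;> fin_cases j <;> simp [gramM])
  refine ⟨by norm_num, ⟨discr_of_cubicGen H₁ (by norm_num), discr_of_cubicGen H₂ (by norm_num),
    discr_of_cubicGen H₃ (by norm_num), discr_of_cubicGen H₄ (by norm_num)⟩,
    ⟨?_, ?_, ?_, ?_, ?_, ?_⟩,
    intTraceEquiv_of G₁ G₂, intTraceEquiv_of G₁ G₃, intTraceEquiv_of G₁ G₄,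
    intTraceEquiv_of G₂ G₃, intTraceEquiv_of G₂ G₄, intTraceEquiv_of G₃ G₄⟩
  · rintro ⟨e⟩
    exact not_algEquiv H₁ (by norm_num) H₂ 11 0 (by decide) (by decide) e.symm
  · rintro ⟨e⟩
    exact not_algEquiv H₁ (by norm_num) H₃ 11 0 (by decide) (by decide) e.symm
  · rintro ⟨e⟩
    exact not_algEquiv H₁ (by norm_num) H₄ 11 0 (by decide) (by decide) e.symm
  · rintro ⟨e⟩
    exact not_algEquiv H₂ (by norm_num) H₃ 3 0 (by decide) (by decide) e.symm
  · rintro ⟨e⟩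
    exact not_algEquiv H₂ (by norm_num) H₄ 3 0 (by decide) (by decide) e.symm
  · rintro ⟨e⟩
    exact not_algEquiv H₄ (by norm_num) H₃ 5 0 (by decide) (by decide) e
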